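/- arXiv:2302.07261 — 3 statements merged into one kernel-verified Lean document; each statement's English description precedes it below -/
import Mathlib

section
/- Let d be a positive integer, let D, Q : ℝ^d → Mat(d×d, ℝ) be twice continuously differentiable matrix-valued functions with Q(y) skew-symmetric (Q(y)ᵀ = −Q(y)) for every y, let H : ℝ^d → ℝ be twice continuously differentiable, and let q : ℝ^d → ℝ be twice continuously differentiable. Define Γ_i(y) = Σ_{j=1}^d ∂/∂y_j ( D_{ij}(y) + Q_{ij}(y) ) and f_i(y) = −Σ_{j=1}^d ( D_{ij}(y) + Q_{ij}(y) ) ∂H/∂y_j (y) + Γ_i(y). Then for every y ∈ ℝ^d, −Σ_{i=1}^d ∂/∂y_i [ f_i(y) q(y) ] + Σ_{i=1}^d Σ_{j=1}^d ∂²/∂y_i∂y_j [ D_{ij}(y) q(y) ] = Σ_{i=1}^d ∂/∂y_i [ Σ_{j=1}^d ( D_{ij}(y) + Q_{ij}(y) ) ( q(y) ∂H/∂y_j(y) + ∂q/∂y_j(y) ) ]. -/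
open Matrix

/-- Partial derivative of a real-valued function on `ℝ^d` in the `i`-th coordinate
direction. -/
noncomputable def pderiv' {d : ℕ} (i : Fin d) (f : (Fin d → ℝ) → ℝ) (y : Fin d → ℝ) : ℝ :=
  fderiv ℝ f y (Pi.single i 1)

section PartialDerivatives

variable {d : ℕ}

lemma pderiv'_add (i : Fin d) {f g : (Fin d → ℝ) → ℝ} {y : Fin d → ℝ}
    (hf : DifferentiableAt ℝ f y) (hg : DifferentiableAt ℝ g y) :
    pderiv' i (fun z => f z + g z) y = pderiv' i f y + pderiv' i g y := by
  simp [pderiv', fderiv_fun_add hf hg]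

lemma pderiv'_sub (i : Fin d) {f g : (Fin d → ℝ) → ℝ} {y : Fin d → ℝ}
    (hf : DifferentiableAt ℝ f y) (hg : DifferentiableAt ℝ g y) :
    pderiv' i (fun z => f z - g z) y = pderiv' i f y - pderiv' i g y := by
  simp [pderiv', fderiv_fun_sub hf hg]

lemma pderiv'_neg (i : Fin d) (f : (Fin d → ℝ) → ℝ) (y : Fin d → ℝ) :
    pderiv' i (fun z => -f z) y = -pderiv' i f y := by
  simp [pderiv', fderiv_fun_neg]

lemma pderiv'_mul (i : Fin d) {f g : (Fin d → ℝ) → ℝ} {y : Fin d → ℝ}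
    (hf : DifferentiableAt ℝ f y) (hg : DifferentiableAt ℝ g y) :
    pderiv' i (fun z => f z * g z) y = f y * pderiv' i g y + g y * pderiv' i f y := by
  simp [pderiv', fderiv_fun_mul hf hg]

lemma pderiv'_sum {ι : Type*} (s : Finset ι) (i : Fin d) {f : ι → (Fin d → ℝ) → ℝ}
    {y : Fin d → ℝ} (hf : ∀ k ∈ s, DifferentiableAt ℝ (f k) y) :
    pderiv' i (fun z => ∑ k ∈ s, f k z) y = ∑ k ∈ s, pderiv' i (f k) y := by
  simp [pderiv', fderiv_fun_sum hf]

lemma ContDiff.differentiable_pderiv' {f : (Fin d → ℝ) → ℝ} (hf : ContDiff ℝ 2 f)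
    (i : Fin d) : Differentiable ℝ (pderiv' i f) :=
  ((hf.fderiv_right (m := 1) (by norm_num)).clm_apply contDiff_const).differentiable
    one_ne_zero

lemma pderiv'_pderiv' {f : (Fin d → ℝ) → ℝ} (hf : ContDiff ℝ 2 f) (i j : Fin d)
    (y : Fin d → ℝ) :
    pderiv' i (pderiv' j f) y = fderiv ℝ (fderiv ℝ f) y (Pi.single i 1) (Pi.single j 1) := by
  have h : DifferentiableAt ℝ (fderiv ℝ f) y :=
    (hf.fderiv_right (m := 1) (by norm_num)).differentiable one_ne_zero y
  change fderiv ℝ (fun z => fderiv ℝ f z (Pi.single j 1)) y (Pi.single i 1) = _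
  simp [fderiv_clm_apply h (differentiableAt_const _)]

lemma pderiv'_comm {f : (Fin d → ℝ) → ℝ} (hf : ContDiff ℝ 2 f) (i j : Fin d)
    (y : Fin d → ℝ) :
    pderiv' i (pderiv' j f) y = pderiv' j (pderiv' i f) y := by
  rw [pderiv'_pderiv' hf, pderiv'_pderiv' hf]
  exact hf.contDiffAt.isSymmSndFDerivAt (by simp) _ _

/-- The double divergence of a skew-symmetric matrix field vanishes. -/
lemma sum_pderiv'_pderiv'_eq_zero_of_skew {A : Fin d → Fin d → (Fin d → ℝ) → ℝ}
    (hA : ∀ i j, ContDiff ℝ 2 (A i j)) (hskew : ∀ i j z, A j i z = -A i j z)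
    (y : Fin d → ℝ) :
    ∑ i : Fin d, ∑ j : Fin d, pderiv' i (pderiv' j (A i j)) y = 0 := by
  have hanti (i j : Fin d) :
      pderiv' j (pderiv' i (A j i)) y = -pderiv' i (pderiv' j (A i j)) y := by
    have h : pderiv' i (A j i) = fun z => -pderiv' i (A i j) z := by
      funext z
      rw [funext (hskew i j), pderiv'_neg]
    rw [h, pderiv'_neg, pderiv'_comm (hA i j)]
  have h : ∑ i, ∑ j, pderiv' i (pderiv' j (A i j)) y =
      -∑ i, ∑ j, pderiv' i (pderiv' j (A i j)) y := by
    refine Finset.sum_comm.trans ?_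
    rw [← Finset.sum_neg_distrib]
    refine Finset.sum_congr rfl fun i _ => ?_
    rw [← Finset.sum_neg_distrib]
    exact Finset.sum_congr rfl fun j _ => hanti i j
  linarith

end PartialDerivatives

/-- The Fokker–Planck right-hand side with drift
`f_i = −∑_j (D_{ij} + Q_{ij}) ∂H/∂y_j + Γ_i`, where
`Γ_i = ∑_j ∂/∂y_j (D_{ij} + Q_{ij})`, and diffusion matrix `D`, applied to a density `q`,
can be rewritten in divergence form, provided `Q(y)` is skew-symmetric for every `y`. -/
theorem fokkerPlanck_divergence_form
    (d : ℕ) (hd : 0 < d)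
    (D Q : (Fin d → ℝ) → Matrix (Fin d) (Fin d) ℝ)
    (hD : ∀ i j : Fin d, ContDiff ℝ 2 (fun y => D y i j))
    (hQ : ∀ i j : Fin d, ContDiff ℝ 2 (fun y => Q y i j))
    (hskew : ∀ y : Fin d → ℝ, (Q y)ᵀ = -Q y)
    (H : (Fin d → ℝ) → ℝ) (hH : ContDiff ℝ 2 H)
    (q : (Fin d → ℝ) → ℝ) (hq : ContDiff ℝ 2 q)
    (Γ : Fin d → (Fin d → ℝ) → ℝ)
    (hΓ : ∀ i y, Γ i y = ∑ j : Fin d, pderiv' j (fun w => D w i j + Q w i j) y)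
    (f : Fin d → (Fin d → ℝ) → ℝ)
    (hf : ∀ i y, f i y = -∑ j : Fin d, (D y i j + Q y i j) * pderiv' j H y + Γ i y) :
    ∀ y : Fin d → ℝ,
      (-∑ i : Fin d, pderiv' i (fun z => f i z * q z) y) +
        ∑ i : Fin d, ∑ j : Fin d,
          pderiv' i (fun z => pderiv' j (fun w => D w i j * q w) z) y =
      ∑ i : Fin d,
        pderiv' i (fun z => ∑ j : Fin d,
          (D z i j + Q z i j) * (q z * pderiv' j H z + pderiv' j q z)) y := by
  intro y
  have hDq (i j : Fin d) : ContDiff ℝ 2 (fun w => D w i j * q w) := (hD i j).mul hq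
  have hQq (i j : Fin d) : ContDiff ℝ 2 (fun w => Q w i j * q w) := (hQ i j).mul hq
  have hDd (i j : Fin d) : Differentiable ℝ (fun w => D w i j) :=
    (hD i j).differentiable two_ne_zero
  have hQd (i j : Fin d) : Differentiable ℝ (fun w => Q w i j) :=
    (hQ i j).differentiable two_ne_zero
  have hqd : Differentiable ℝ q := hq.differentiable two_ne_zero
  have hflux (i : Fin d) : (fun z => f i z * q z) = fun z =>
      ((∑ j, pderiv' j (fun w => D w i j * q w) z) +
        ∑ j, pderiv' j (fun w => Q w i j * q w) z) -
      ∑ j, (D z i j + Q z i j) * (q z * pderiv' j H z + pderiv' j q z) := by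
    funext z
    rw [hf, hΓ, add_mul, neg_mul, Finset.sum_mul, Finset.sum_mul, ← Finset.sum_neg_distrib,
      ← Finset.sum_add_distrib, ← Finset.sum_add_distrib, ← Finset.sum_sub_distrib]
    refine Finset.sum_congr rfl fun j _ => ?_
    rw [pderiv'_add j (hDd i j z) (hQd i j z), pderiv'_mul j (hDd i j z) (hqd z),
      pderiv'_mul j (hQd i j z) (hqd z)]
    ring
  have hD' (i j : Fin d) := (hDq i j).differentiable_pderiv' j y
  have hQ' (i j : Fin d) := (hQq i j).differentiable_pderiv' j y
  have hJ (i j : Fin d) : DifferentiableAt ℝ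
      (fun z => (D z i j + Q z i j) * (q z * pderiv' j H z + pderiv' j q z)) y :=
    ((hDd i j y).add (hQd i j y)).mul
      (((hqd y).mul (hH.differentiable_pderiv' j y)).add (hq.differentiable_pderiv' j y))
  have hdiv (i : Fin d) : pderiv' i (fun z => f i z * q z) y =
      (∑ j, pderiv' i (pderiv' j (fun w => D w i j * q w)) y) +
        (∑ j, pderiv' i (pderiv' j (fun w => Q w i j * q w)) y) -
      pderiv' i (fun z => ∑ j,
        (D z i j + Q z i j) * (q z * pderiv' j H z + pderiv' j q z)) y := by
    have hDs := DifferentiableAt.fun_sum (u := Finset.univ) fun j _ => hD' i j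
    have hQs := DifferentiableAt.fun_sum (u := Finset.univ) fun j _ => hQ' i j
    have hJs := DifferentiableAt.fun_sum (u := Finset.univ) fun j _ => hJ i j
    rw [hflux, pderiv'_sub i (hDs.fun_add hQs) hJs, pderiv'_add i hDs hQs,
      pderiv'_sum _ i fun j _ => hD' i j, pderiv'_sum _ i fun j _ => hQ' i j]
  have hzero := sum_pderiv'_pderiv'_eq_zero_of_skew hQq
    (fun i j z => by
      have h : Q z j i = -Q z i j := congrFun (congrFun (hskew z) i) j
      rw [h, neg_mul]) y
  simp only [hdiv, Finset.sum_sub_distrib, Finset.sum_add_distrib, hzero]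
  ring
end

section
/- Let n be a positive integer, let I ⊆ ℝ be an interval containing 0, let A, G : I → Mat(n×n, ℝ) be continuous, and let C, H : I → Mat(n×n, ℝ) be differentiable functions satisfying the block linear ODE system C′(s) = A(s) C(s) + G(s) H(s) and H′(s) = −A(s)ᵀ H(s) for all s ∈ I, with initial conditions C(0) = Σ₀ and H(0) = I_n (the identity matrix). Assume H(s) is invertible for every s ∈ I. Then the function Σ(s) := C(s) H(s)⁻¹ is differentiable on I, satisfies Σ(0) = Σ₀, and solves the matrix Lyapunov differential equation dΣ/ds = A(s) Σ(s) + Σ(s) A(s)ᵀ + G(s) for all s ∈ I. -/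
open Matrix

attribute [local instance] Matrix.normedAddCommGroup Matrix.normedSpace

/-- The derivative of `t ↦ f t * (g t)⁻¹` in a complete normed algebra, where `g` is a unit. -/
theorem HasDerivWithinAt.mul_ringInverse {R : Type*} [NormedRing R] [NormedAlgebra ℝ R]
    [CompleteSpace R] {f g : ℝ → R} {f' g' : R} {s : Set ℝ} {x : ℝ}
    (hf : HasDerivWithinAt f f' s x) (hg : HasDerivWithinAt g g' s x) (hx : IsUnit (g x)) :
    HasDerivWithinAt (fun t => f t * Ring.inverse (g t))
      (f' * Ring.inverse (g x) - f x * (Ring.inverse (g x) * g' * Ring.inverse (g x))) s x := by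
  obtain ⟨u, hu⟩ := hx
  have hinv : HasFDerivAt Ring.inverse (-ContinuousLinearMap.mulLeftRight ℝ R ↑u⁻¹ ↑u⁻¹) (g x) :=
    hu ▸ hasFDerivAt_ringInverse u
  refine (hf.mul (hinv.comp_hasDerivWithinAt x hg)).congr_deriv ?_
  simp [← hu, sub_eq_add_neg]

/-- The derivative of `t ↦ f t * (g t)⁻¹` for matrix-valued functions, where `g` is invertible. -/
theorem HasDerivWithinAt.matrix_mul_inv {m : Type*} [Fintype m] [DecidableEq m]
    {f g : ℝ → Matrix m m ℝ} {f' g' : Matrix m m ℝ} {s : Set ℝ} {x : ℝ}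
    (hf : HasDerivWithinAt f f' s x) (hg : HasDerivWithinAt g g' s x) (hx : IsUnit (g x)) :
    HasDerivWithinAt (fun t => f t * (g t)⁻¹)
      (f' * (g x)⁻¹ - f x * ((g x)⁻¹ * g' * (g x)⁻¹)) s x := by
  simp only [Matrix.nonsing_inv_eq_ringInverse]
  let instRing : NormedRing (Matrix m m ℝ) := Matrix.linftyOpNormedRing
  let instAlgebra : NormedAlgebra ℝ (Matrix m m ℝ) := Matrix.linftyOpNormedAlgebra
  have instComplete : @CompleteSpace (Matrix m m ℝ) instRing.toUniformSpace :=
    FiniteDimensional.complete ℝ (m → m → ℝ)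
  exact @HasDerivWithinAt.mul_ringInverse _ instRing instAlgebra instComplete _ _ _ _ _ _ hf hg hx

/-- If `C, H` solve the block linear ODE system `C′ = A C + G H`, `H′ = −Aᵀ H` on an
interval `I` containing `0`, with `C 0 = S₀`, `H 0 = I_n`, and `H s` invertible on `I`,
then `Σ(s) := C(s) H(s)⁻¹` is differentiable on `I`, satisfies `Σ(0) = S₀`, and solves the
matrix Lyapunov differential equation `dΣ/ds = A Σ + Σ Aᵀ + G` on `I`. -/
theorem lyapunov_of_block_ode
    (n : ℕ) (hn : 0 < n) (I : Set ℝ) (hI : I.OrdConnected) (h0I : (0 : ℝ) ∈ I)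
    (A G C H : ℝ → Matrix (Fin n) (Fin n) ℝ)
    (hA : ContinuousOn A I) (hG : ContinuousOn G I)
    (S₀ : Matrix (Fin n) (Fin n) ℝ)
    (hC : ∀ s ∈ I, HasDerivWithinAt C (A s * C s + G s * H s) I s)
    (hH : ∀ s ∈ I, HasDerivWithinAt H (-(A s)ᵀ * H s) I s)
    (hC0 : C 0 = S₀) (hH0 : H 0 = 1)
    (hinv : ∀ s ∈ I, IsUnit (H s)) :
    C 0 * (H 0)⁻¹ = S₀ ∧
      ∀ s ∈ I,
        HasDerivWithinAt (fun s => C s * (H s)⁻¹)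
          (A s * (C s * (H s)⁻¹) + (C s * (H s)⁻¹) * (A s)ᵀ + G s) I s := by
  refine ⟨by simp [hC0, hH0], fun s hs => ?_⟩
  have hmul : H s * (H s)⁻¹ = 1 :=
    Matrix.mul_nonsing_inv _ ((Matrix.isUnit_iff_isUnit_det _).1 (hinv s hs))
  convert (hC s hs).matrix_mul_inv (hH s hs) (hinv s hs) using 1
  simp only [add_mul, neg_mul, mul_neg, mul_assoc, hmul, mul_one, sub_neg_eq_add]
  abel
end

section
/- Let d be a positive integer, let x₀ be an ℝ^d-valued random vector with law μ and E[‖x₀‖] < ∞, let A ∈ Mat(d×d, ℝ) be invertible, let Σ ∈ Mat(d×d, ℝ) be symmetric positive definite, let ε be an ℝ^d-valued Gaussian random vector with mean 0 and covariance Σ, independent of x₀, and set y := A x₀ + ε. Then y has a strictly positive continuously differentiable density q given by q(u) = ∫ φ_Σ(u − A x) dμ(x), where φ_Σ(u) = (2π)^{−d/2}(det Σ)^{−1/2} exp(−(1/2)⟨u, Σ⁻¹ u⟩), and the conditional expectation of x₀ given y satisfies, almost surely, E[ x₀ | y ] = A⁻¹ Σ ∇ log q(y) + A⁻¹ y. 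-/
open Matrix MeasureTheory ProbabilityTheory

/-- The density `φ_Σ` of the centered Gaussian `N(0, Σ)` on `ℝ^d`:
`φ_Σ(u) = (2π)^{−d/2} (det Σ)^{−1/2} exp(−(1/2)⟨u, Σ⁻¹ u⟩)`. -/
noncomputable def gaussDensity₀ {d : ℕ} (S : Matrix (Fin d) (Fin d) ℝ)
    (u : Fin d → ℝ) : ℝ :=
  (2 * Real.pi) ^ (-(d : ℝ) / 2) * S.det ^ (-(1 : ℝ) / 2) *
    Real.exp (-(1 / 2 : ℝ) * (u ⬝ᵥ S⁻¹.mulVec u))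

/-- Differentiation under the integral sign for the smoothing `u ↦ E[G (u - Z)]` of a bounded `C¹`
function `G` whose derivative has at most linear growth, when `Z` is integrable. -/
theorem hasFDerivAt_integral_sub_and_continuous {E α : Type*} [NormedAddCommGroup E]
    [NormedSpace ℝ E] [MeasurableSpace α] {μ : Measure α} [IsFiniteMeasure μ]
    {Z : α → E} (hZ : Integrable Z μ) {G : E → ℝ} {G' : E → E →L[ℝ] ℝ} {C K : ℝ}
    (hK : 0 ≤ K) (hG' : ∀ u, HasFDerivAt G (G' u) u) (hG'_cont : Continuous G')
    (hG_bound : ∀ u, ‖G u‖ ≤ C) (hG'_bound : ∀ u, ‖G' u‖ ≤ K * ‖u‖) :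
    (∀ u, HasFDerivAt (fun v => ∫ a, G (v - Z a) ∂μ) (∫ a, G' (u - Z a) ∂μ) u) ∧
    Continuous (fun u => ∫ a, G' (u - Z a) ∂μ) := by
  have hG_cont : Continuous G := continuous_iff_continuousAt.2 fun u => (hG' u).continuousAt
  have hmeas (u : E) : AEStronglyMeasurable (fun a => G (u - Z a)) μ :=
    hG_cont.comp_aestronglyMeasurable (aestronglyMeasurable_const.sub hZ.1)
  have hmeas' (u : E) : AEStronglyMeasurable (fun a => G' (u - Z a)) μ :=
    hG'_cont.comp_aestronglyMeasurable (aestronglyMeasurable_const.sub hZ.1)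
  have hbound (u v : E) (hv : v ∈ Metric.ball u 1) (a : α) :
      ‖G' (v - Z a)‖ ≤ K * (‖u‖ + 1 + ‖Z a‖) := by
    refine (hG'_bound _).trans (mul_le_mul_of_nonneg_left ?_ hK)
    have h1 : ‖v‖ ≤ ‖u‖ + 1 := by
      have := norm_le_norm_add_norm_sub' v u
      rw [mem_ball_iff_norm] at hv
      linarith
    linarith [norm_sub_le v (Z a)]
  have hbound_int (u : E) : Integrable (fun a => K * (‖u‖ + 1 + ‖Z a‖)) μ :=
    ((integrable_const _).add hZ.norm).const_mul K
  refine ⟨fun u => ?_, ?_⟩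
  · refine hasFDerivAt_integral_of_dominated_of_fderiv_le
      (Metric.ball_mem_nhds u one_pos) (Filter.Eventually.of_forall hmeas)
      (Integrable.of_bound (hmeas u) C (ae_of_all _ fun a => hG_bound _)) (hmeas' u)
      (ae_of_all _ fun a v hv => hbound u v hv a) (hbound_int u)
      (ae_of_all _ fun a v _ => ?_)
    simpa [Function.comp_def] using (hG' (v - Z a)).comp v ((hasFDerivAt_id v).sub_const (Z a))
  · refine continuous_iff_continuousAt.2 fun u => continuousAt_of_dominated
      (Filter.Eventually.of_forall hmeas') ?_ (hbound_int u) (ae_of_all _ fun a => ?_)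
    · filter_upwards [Metric.ball_mem_nhds u one_pos] with v hv
      exact ae_of_all _ (hbound u v hv)
    · exact (hG'_cont.comp (continuous_id.sub continuous_const)).continuousAt

theorem setIntegral_withDensity_ofReal {α F : Type*} [MeasurableSpace α] {ν : Measure α}
    [NormedAddCommGroup F] [NormedSpace ℝ F] {k : α → ℝ} (hk : Measurable k) (hk0 : ∀ a, 0 ≤ k a)
    (f : α → F) {s : Set α} (hs : MeasurableSet s) :
    ∫ a in s, f a ∂(ν.withDensity fun a => ENNReal.ofReal (k a)) = ∫ a in s, k a • f a ∂ν := by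
  rw [setIntegral_withDensity_eq_setIntegral_toReal_smul hk.ennreal_ofReal
    (ae_of_all _ fun _ => ENNReal.ofReal_lt_top) f hs]
  simp [ENNReal.toReal_ofReal, hk0]

theorem integrable_withDensity_ofReal_iff {α F : Type*} [MeasurableSpace α] {ν : Measure α}
    [NormedAddCommGroup F] [NormedSpace ℝ F] {k : α → ℝ} (hk : Measurable k) (hk0 : ∀ a, 0 ≤ k a)
    {f : α → F} :
    Integrable f (ν.withDensity fun a => ENNReal.ofReal (k a)) ↔
      Integrable (fun a => k a • f a) ν := by
  rw [integrable_withDensity_iff_integrable_smul' hk.ennreal_ofReal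
    (ae_of_all _ fun _ => ENNReal.ofReal_lt_top)]
  simp [ENNReal.toReal_ofReal, hk0]

/-- The second marginal of a joint density is obtained by integrating out the first variable. -/
theorem map_snd_withDensity_prod {α β : Type*} [MeasurableSpace α] [MeasurableSpace β]
    {μ : Measure α} {ν : Measure β} [SFinite μ] [SFinite ν] {k : α × β → ℝ}
    (hk : Measurable k) (hk0 : ∀ p, 0 ≤ k p) (hk_int : ∀ b, Integrable (fun a => k (a, b)) μ) :
    ((μ.prod ν).withDensity fun p => ENNReal.ofReal (k p)).map Prod.snd =
      ν.withDensity fun b => ENNReal.ofReal (∫ a, k (a, b) ∂μ) := by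
  ext s hs
  rw [Measure.map_apply measurable_snd hs, withDensity_apply _ (measurable_snd hs),
    withDensity_apply _ hs, ← Set.univ_prod, ← Measure.prod_restrict, Measure.restrict_univ,
    lintegral_prod_symm' _ hk.ennreal_ofReal]
  refine lintegral_congr fun b => ?_
  rw [ofReal_integral_eq_lintegral_ofReal (hk_int b) (ae_of_all _ fun a => hk0 (a, b))]

/-- Bayes' formula: the conditional expectation of `X` given `y` in terms of a joint density. -/
theorem condExp_comap_of_joint_density {Ω F β : Type*} [MeasurableSpace Ω] {P : Measure Ω}
    [IsProbabilityMeasure P] [NormedAddCommGroup F] [NormedSpace ℝ F] [CompleteSpace F]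
    [MeasurableSpace F] [BorelSpace F] [SecondCountableTopology F] [mβ : MeasurableSpace β]
    {μ : Measure F} {ν : Measure β} [SFinite μ] [SFinite ν]
    {X : Ω → F} {y : Ω → β} (hX : Measurable X) (hX_int : Integrable X P) (hy : Measurable y)
    {k : F × β → ℝ} (hk : Measurable k) (hk0 : ∀ p, 0 ≤ k p)
    (hk_int : ∀ b, Integrable (fun x => k (x, b)) μ) (hk_pos : ∀ b, 0 < ∫ x, k (x, b) ∂μ)
    (hlaw : P.map (fun ω => (X ω, y ω)) =
      (μ.prod ν).withDensity fun p => ENNReal.ofReal (k p)) :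
    P[X | MeasurableSpace.comap y mβ] =ᵐ[P]
      fun ω => (∫ x, k (x, y ω) ∂μ)⁻¹ • ∫ x, k (x, y ω) • x ∂μ := by
  set q : β → ℝ := fun b => ∫ x, k (x, b) ∂μ
  set m : β → F := fun b => ∫ x, k (x, b) • x ∂μ
  have hXy : Measurable fun ω => (X ω, y ω) := hX.prodMk hy
  have hq_meas : Measurable q :=
    (hk.stronglyMeasurable.integral_prod_left' (μ := μ)).measurable
  have hm_meas : StronglyMeasurable m :=
    (hk.smul measurable_fst).stronglyMeasurable.integral_prod_left' (μ := μ)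
  have hg_meas : StronglyMeasurable fun b => (q b)⁻¹ • m b :=
    hq_meas.inv.stronglyMeasurable.smul hm_meas
  have hlaw_y : P.map y = ν.withDensity fun b => ENNReal.ofReal (q b) := by
    rw [← map_snd_withDensity_prod hk hk0 hk_int, ← hlaw, Measure.map_map measurable_snd hXy]
    rfl
  have hq0 (b : β) : 0 ≤ q b := (hk_pos b).le
  have hqm (b : β) : q b • (q b)⁻¹ • m b = m b := smul_inv_smul₀ (hk_pos b).ne' _
  have hkx_int : Integrable (fun p : F × β => k p • p.1) (μ.prod ν) := by
    rw [← integrable_withDensity_ofReal_iff hk hk0, ← hlaw,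
      integrable_map_measure measurable_fst.aestronglyMeasurable hXy.aemeasurable]
    exact hX_int
  have hg_int : Integrable (fun ω => (q (y ω))⁻¹ • m (y ω)) P := by
    refine (integrable_map_measure (g := fun b => (q b)⁻¹ • m b)
      hg_meas.aestronglyMeasurable hy.aemeasurable).1 ?_
    rw [hlaw_y, integrable_withDensity_ofReal_iff hq_meas hq0]
    simp_rw [hqm]
    exact hkx_int.integral_prod_right
  refine (ae_eq_condExp_of_forall_setIntegral_eq hy.comap_le hX_int
    (fun _ _ _ => hg_int.integrableOn) ?_ ?_).symm
  · rintro _ ⟨s, hs, rfl⟩ -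
    calc ∫ ω in y ⁻¹' s, (q (y ω))⁻¹ • m (y ω) ∂P
        = ∫ b in s, (q b)⁻¹ • m b ∂(P.map y) :=
          (setIntegral_map hs hg_meas.aestronglyMeasurable hy.aemeasurable).symm
      _ = ∫ b in s, m b ∂ν := by
          rw [hlaw_y, setIntegral_withDensity_ofReal hq_meas hq0 _ hs]
          simp_rw [hqm]
      _ = ∫ p in Set.univ ×ˢ s, k p • p.1 ∂(μ.prod ν) := by
          rw [← Measure.prod_restrict, Measure.restrict_univ, integral_prod_symm]
          rw [← Measure.restrict_univ (μ := μ), Measure.prod_restrict]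
          exact hkx_int.integrableOn
      _ = ∫ p in Set.univ ×ˢ s, p.1 ∂(P.map fun ω => (X ω, y ω)) := by
          rw [hlaw, setIntegral_withDensity_ofReal hk hk0 _ (MeasurableSet.univ.prod hs)]
      _ = ∫ ω in y ⁻¹' s, X ω ∂P := by
          rw [setIntegral_map (MeasurableSet.univ.prod hs)
            measurable_fst.aestronglyMeasurable hXy.aemeasurable, Set.mk_preimage_prod]
          simp
  · exact (hg_meas.comp_measurable (comap_measurable y)).aestronglyMeasurable

/-- If the noise `ε` is independent of `X` and has density `G`, then `f X + ε` has conditional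
density `u ↦ G (u - f x)` given `X = x`. -/
theorem map_prodMk_add_of_indepFun {Ω E F : Type*} [MeasurableSpace Ω] {P : Measure Ω}
    [IsProbabilityMeasure P] [MeasurableSpace F] [AddCommGroup E] [MeasurableSpace E]
    [MeasurableAdd₂ E] [MeasurableSub₂ E] {ν : Measure E} [SFinite ν] [ν.IsAddLeftInvariant]
    {X : Ω → F} {ε : Ω → E} (hX : Measurable X) (hε : Measurable ε) (hindep : IndepFun X ε P)
    {f : F → E} (hf : Measurable f) {G : E → ENNReal} (hG : Measurable G)
    (hε_law : P.map ε = ν.withDensity G) :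
    P.map (fun ω => (X ω, f (X ω) + ε ω)) =
      ((P.map X).prod ν).withDensity fun p => G (p.2 - f p.1) := by
  have := Measure.isProbabilityMeasure_map (μ := P) hX.aemeasurable
  have hjoint := (indepFun_iff_map_prod_eq_prod_map_map hX.aemeasurable hε.aemeasurable).1 hindep
  have hshift : Measurable fun p : F × E => (p.1, f p.1 + p.2) :=
    measurable_fst.prodMk ((hf.comp measurable_fst).add measurable_snd)
  have hk : Measurable fun p : F × E => G (p.2 - f p.1) :=
    hG.comp (measurable_snd.sub (hf.comp measurable_fst))
  have hcomp : P.map (fun ω => (X ω, f (X ω) + ε ω)) =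
      (P.map fun ω => (X ω, ε ω)).map fun p => (p.1, f p.1 + p.2) := by
    rw [Measure.map_map hshift (hX.prodMk hε)]
    rfl
  have := Measure.isProbabilityMeasure_map (μ := P) hε.aemeasurable
  refine Measure.ext_of_lintegral _ fun h hh => ?_
  rw [hcomp, lintegral_map hh hshift, hjoint,
    lintegral_prod (fun p => h (p.1, f p.1 + p.2)) (hh.comp hshift).aemeasurable,
    lintegral_withDensity_eq_lintegral_mul _ hk hh, lintegral_prod _ (hk.mul hh).aemeasurable]
  refine lintegral_congr fun x => ?_
  rw [hε_law, lintegral_withDensity_eq_lintegral_mul _ hG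
    (show Measurable fun e => h (x, f x + e) from
      hh.comp (hshift.comp measurable_prodMk_left))]
  refine Eq.trans ?_ (lintegral_add_left_eq_self (fun e => G (e - f x) * h (x, e)) (f x))
  simp

/-- The function `u ↦ c exp(-⟨u, T u⟩ / 2)` has derivative `-G(u) ⟨T u, ·⟩`. -/
theorem hasFDerivAt_const_mul_exp_neg_half {E : Type*} [NormedAddCommGroup E] [NormedSpace ℝ E]
    (T : E →L[ℝ] E →L[ℝ] ℝ) (hT : ∀ u v, T u v = T v u) (c : ℝ) (u : E) :
    HasFDerivAt (fun u => c * Real.exp (-(1 / 2 : ℝ) * T u u))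
      (-(c * Real.exp (-(1 / 2 : ℝ) * T u u)) • T u) u := by
  have h1 : HasFDerivAt (fun u => T u u) (T u + T.flip u) u := by
    convert! T.hasFDerivAt.clm_apply (hasFDerivAt_id u) using 1
  convert! ((h1.const_mul (-(1 / 2 : ℝ))).exp).const_mul c using 1
  ext v
  simp [hT v u]
  ring

/-- Multivariate Tweedie formula for a linear-Gaussian observation model: if
`y = A x₀ + ε` with `x₀ ∼ μ` integrable, `A` invertible, and `ε ∼ N(0, Σ)` independent of
`x₀`, then `y` has the strictly positive `C¹` density `q(u) = ∫ φ_Σ(u − A x) dμ(x)`, and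
almost surely `E[x₀ | y] = A⁻¹ Σ ∇log q(y) + A⁻¹ y`. -/
theorem multivariate_tweedie
    (d : ℕ) (hd : 0 < d)
    (Ω : Type*) [MeasurableSpace Ω] (P : Measure Ω) [IsProbabilityMeasure P]
    (X : Ω → Fin d → ℝ) (hX_meas : Measurable X) (hX_int : Integrable X P)
    (A : Matrix (Fin d) (Fin d) ℝ) (hA : IsUnit A)
    (S : Matrix (Fin d) (Fin d) ℝ) (hS : S.PosDef)
    (ε : Ω → Fin d → ℝ) (hε_meas : Measurable ε)
    (hε_law : P.map ε =
      (volume : Measure (Fin d → ℝ)).withDensity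
        (fun u => ENNReal.ofReal (gaussDensity₀ S u)))
    (hindep : IndepFun X ε P)
    (y : Ω → Fin d → ℝ) (hy : ∀ ω, y ω = A.mulVec (X ω) + ε ω)
    (q : (Fin d → ℝ) → ℝ)
    (hq_def : ∀ u, q u = ∫ x, gaussDensity₀ S (u - A.mulVec x) ∂(P.map X)) :
    (∀ u, 0 < q u) ∧ ContDiff ℝ 1 q ∧
    (P.map y =
      (volume : Measure (Fin d → ℝ)).withDensity (fun u => ENNReal.ofReal (q u))) ∧
    (P[X|MeasurableSpace.comap y inferInstance] =ᵐ[P]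
      fun ω =>
        A⁻¹.mulVec (S.mulVec
          (fun i => fderiv ℝ (fun u => Real.log (q u)) (y ω) (Pi.single i 1))) +
        A⁻¹.mulVec (y ω)) := by
  have hc : 0 < (2 * Real.pi) ^ (-(d : ℝ) / 2) * S.det ^ (-(1 : ℝ) / 2) :=
    mul_pos (Real.rpow_pos_of_pos Real.two_pi_pos _) (Real.rpow_pos_of_pos hS.det_pos _)
  set T : (Fin d → ℝ) →L[ℝ] (Fin d → ℝ) →L[ℝ] ℝ :=
    (Matrix.toBilin' S⁻¹).toContinuousBilinearMap
  have hT_apply (u v : Fin d → ℝ) : T u v = u ⬝ᵥ S⁻¹ *ᵥ v := Matrix.toBilin'_apply' S⁻¹ u v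
  have hS_symm : (S⁻¹)ᵀ = S⁻¹ := by
    simpa using hS.inv.isHermitian.eq
  have hT_symm (u v : Fin d → ℝ) : T u v = T v u := by
    rw [hT_apply, hT_apply, dotProduct_comm, ← vecMul_transpose, hS_symm, ← dotProduct_mulVec]
  have hT_nonneg (u : Fin d → ℝ) : 0 ≤ T u u := by
    rw [hT_apply]
    simpa using hS.inv.posSemidef.dotProduct_mulVec_nonneg u
  set c := (2 * Real.pi) ^ (-(d : ℝ) / 2) * S.det ^ (-(1 : ℝ) / 2)
  have hG_eq : gaussDensity₀ S = fun u => c * Real.exp (-(1 / 2 : ℝ) * T u u) := by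
    funext u
    rw [gaussDensity₀, hT_apply]
  have hG_pos (u : Fin d → ℝ) : 0 < gaussDensity₀ S u := by
    rw [hG_eq]
    positivity
  have hG_bound (u : Fin d → ℝ) : ‖gaussDensity₀ S u‖ ≤ c := by
    rw [Real.norm_of_nonneg (hG_pos u).le, hG_eq]
    refine mul_le_of_le_one_right hc.le (Real.exp_le_one_iff.2 ?_)
    linarith [hT_nonneg u]
  have hG' (u : Fin d → ℝ) :
      HasFDerivAt (gaussDensity₀ S) (-gaussDensity₀ S u • T u) u := by
    rw [hG_eq]
    exact hasFDerivAt_const_mul_exp_neg_half T hT_symm c u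
  have hG_cont : Continuous (gaussDensity₀ S) :=
    continuous_iff_continuousAt.2 fun u => (hG' u).continuousAt
  have hG'_bound (u : Fin d → ℝ) : ‖-gaussDensity₀ S u • T u‖ ≤ c * ‖T‖ * ‖u‖ := by
    rw [norm_smul, norm_neg, mul_assoc]
    exact mul_le_mul (hG_bound u) (T.le_opNorm u) (norm_nonneg _) hc.le
  set μ := P.map X
  have : IsProbabilityMeasure μ := Measure.isProbabilityMeasure_map hX_meas.aemeasurable
  have hid_int : Integrable (fun x : Fin d → ℝ => x) μ :=
    (integrable_map_measure aestronglyMeasurable_id hX_meas.aemeasurable).2 hX_int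
  set L : (Fin d → ℝ) →L[ℝ] (Fin d → ℝ) := (Matrix.mulVecLin A).toContinuousLinearMap
  have hL_apply (x : Fin d → ℝ) : L x = A *ᵥ x := rfl
  have hL_int : Integrable (fun x => A *ᵥ x) μ := L.integrable_comp hid_int
  obtain ⟨hq_deriv, hD_cont⟩ := hasFDerivAt_integral_sub_and_continuous hL_int
    (by positivity) hG' (hG_cont.neg.smul T.continuous) hG_bound hG'_bound
  obtain rfl : q = fun u => ∫ x, gaussDensity₀ S (u - A *ᵥ x) ∂μ := funext hq_def
  have hA_meas : Measurable fun x : Fin d → ℝ => A *ᵥ x := L.continuous.measurable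
  have hk_meas : Measurable fun p : (Fin d → ℝ) × (Fin d → ℝ) =>
      gaussDensity₀ S (p.2 - A *ᵥ p.1) :=
    hG_cont.measurable.comp (measurable_snd.sub (hA_meas.comp measurable_fst))
  have hk_int (u : Fin d → ℝ) : Integrable (fun x => gaussDensity₀ S (u - A *ᵥ x)) μ :=
    Integrable.of_bound (hk_meas.comp measurable_prodMk_right).aestronglyMeasurable c
      (ae_of_all _ fun x => hG_bound _)
  have hq_pos (u : Fin d → ℝ) : 0 < ∫ x, gaussDensity₀ S (u - A *ᵥ x) ∂μ := by
    rw [integral_pos_iff_support_of_nonneg (fun x => (hG_pos _).le) (hk_int u)]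
    have : (Function.support fun x => gaussDensity₀ S (u - A *ᵥ x)) = Set.univ :=
      Set.eq_univ_of_forall fun x => (hG_pos _).ne'
    simp [this]
  obtain rfl : y = fun ω => A *ᵥ X ω + ε ω := funext hy
  have hy_meas : Measurable fun ω => A *ᵥ X ω + ε ω := (hA_meas.comp hX_meas).add hε_meas
  have hlaw := map_prodMk_add_of_indepFun hX_meas hε_meas hindep hA_meas
    hG_cont.measurable.ennreal_ofReal hε_law
  refine ⟨hq_pos, contDiff_one_iff_hasFDerivAt.2 ⟨_, hD_cont, hq_deriv⟩, ?_, ?_⟩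
  · rw [← map_snd_withDensity_prod hk_meas (fun p => (hG_pos _).le) hk_int, ← hlaw,
      Measure.map_map measurable_snd (hX_meas.prodMk hy_meas)]
    rfl
  · refine (condExp_comap_of_joint_density hX_meas hX_int hy_meas hk_meas
      (fun p => (hG_pos _).le) hk_int hq_pos hlaw).trans (ae_of_all _ fun ω => ?_)
    dsimp only
    generalize A *ᵥ X ω + ε ω = u
    have hxG_int : Integrable (fun x => gaussDensity₀ S (u - A *ᵥ x) • x) μ :=
      hid_int.bdd_smul c (hk_int u).1 (ae_of_all _ fun x => hG_bound _)
    set Q := ∫ x, gaussDensity₀ S (u - A *ᵥ x) ∂μ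
    set M := ∫ x, gaussDensity₀ S (u - A *ᵥ x) • x ∂μ with hM
    have hQ0 : Q ≠ 0 := (hq_pos u).ne'
    have hsub_int : ∫ x, gaussDensity₀ S (u - A *ᵥ x) • (u - A *ᵥ x) ∂μ = Q • u - A *ᵥ M := by
      have h1 : A *ᵥ M = ∫ x, gaussDensity₀ S (u - A *ᵥ x) • A *ᵥ x ∂μ := by
        rw [hM, ← hL_apply, ← L.integral_comp_comm hxG_int]
        simp [hL_apply, mulVec_smul]
      have h2 : Integrable (fun x => gaussDensity₀ S (u - A *ᵥ x) • A *ᵥ x) μ := by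
        simpa [hL_apply, mulVec_smul] using L.integrable_comp hxG_int
      simp_rw [smul_sub]
      rw [integral_sub ((hk_int u).smul_const u) h2, integral_smul_const, h1]
    have hD : ∫ x, -gaussDensity₀ S (u - A *ᵥ x) • T (u - A *ᵥ x) ∂μ = -T (Q • u - A *ᵥ M) := by
      have h2 : Integrable (fun x => gaussDensity₀ S (u - A *ᵥ x) • (u - A *ᵥ x)) μ := by
        simp_rw [smul_sub]
        refine ((hk_int u).smul_const u).sub ?_
        simpa [hL_apply, mulVec_smul] using L.integrable_comp hxG_int
      rw [← hsub_int, ← T.integral_comp_comm h2, ← integral_neg]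
      refine integral_congr_ae (ae_of_all _ fun x => ?_)
      ext v
      simp
    have hlog : HasFDerivAt (fun v => Real.log (∫ x, gaussDensity₀ S (v - A *ᵥ x) ∂μ))
        (Q⁻¹ • -T (Q • u - A *ᵥ M)) u := by
      rw [← hD]
      exact (hq_deriv u).log hQ0
    have hgrad : (fun i => (Q⁻¹ • -T (Q • u - A *ᵥ M)) (Pi.single i 1)) =
        S⁻¹ *ᵥ (Q⁻¹ • A *ᵥ M - u) := by
      have h1 : Q⁻¹ • -T (Q • u - A *ᵥ M) = T (Q⁻¹ • A *ᵥ M - u) := by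
        rw [← map_neg, ← map_smul, neg_sub, smul_sub, inv_smul_smul₀ hQ0]
      funext i
      rw [h1, hT_symm, hT_apply, single_one_dotProduct]
    have hA_det : IsUnit A.det := (Matrix.isUnit_iff_isUnit_det A).1 hA
    have hS_det : IsUnit S.det := hS.det_pos.ne'.isUnit
    rw [hlog.fderiv, hgrad, mulVec_mulVec _ S, Matrix.mul_nonsing_inv S hS_det, one_mulVec,
      ← mulVec_add, sub_add_cancel, mulVec_smul, mulVec_mulVec, Matrix.nonsing_inv_mul A hA_det,
      one_mulVec]
end
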